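/- The Banach envelope of $QA_{\varphi,\psi}$ is the Lorentz space $\Lambda_\varphi$. Precisely: letting $B=\{g\in QA_{\varphi,\psi} : \|g\|_{\varphi,\psi}\le 1\}$ and $\|f\|^c=\inf\{\alpha>0 : f\in\alpha\,\mathrm{conv}(B)\}$ be the gauge (Mackey norm) of the convex hull of $B$, one has $\|f\|^c=\psi(1)\,\|f\|_{\Lambda_\varphi}$ for every $f\in QA_{\varphi,\psi}$; moreover $QA_{\varphi,\psi}$ is dense in $(\Lambda_\varphi,\|\cdot\|_{\Lambda_\varphi})$, so the completion of $(QA_{\varphi,\psi},\|\cdot\|^c)$ is $\Lambda_\varphi$ with norm $\psi(1)\|\cdot\|_{\Lambda_\varphi}$. -/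

import Mathlib

open MeasureTheory ENNReal Set Filter Topology

noncomputable section

/-- Lebesgue measure restricted to the interval `[0,1]`. -/
def μ01 : Measure ℝ := volume.restrict (Set.Icc 0 1)

/-- `φ : [0,1] → [0,∞)` is concave, non-decreasing, and vanishes only at the origin. -/
structure IsPhi (φ : ℝ → ℝ) : Prop where
  concave : ConcaveOn ℝ (Set.Icc 0 1) φ
  mono : MonotoneOn φ (Set.Icc 0 1)
  zero : φ 0 = 0
  pos : ∀ t : ℝ, 0 < t → t ≤ 1 → 0 < φ t

/-- `ψ : [0,∞) → [0,∞)` is concave, non-decreasing, and vanishes only at the origin. -/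
structure IsPsi (ψ : ℝ → ℝ) : Prop where
  concave : ConcaveOn ℝ (Set.Ici 0) ψ
  mono : MonotoneOn ψ (Set.Ici 0)
  zero : ψ 0 = 0
  pos : ∀ t : ℝ, 0 < t → 0 < ψ t

/-- A sequence `g` of nonnegative `L^∞` functions with `|f| ≤ ∑ₙ gₙ` a.e. -/
def Admissible (f : ℝ → ℝ) (g : ℕ → ℝ → ℝ) : Prop :=
  (∀ n, AEMeasurable (g n) μ01) ∧
  (∀ n, eLpNorm (g n) ⊤ μ01 < ⊤) ∧
  (∀ n x, 0 ≤ g n x) ∧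
  (∀ᵐ x ∂μ01, ENNReal.ofReal |f x| ≤ ∑' n : ℕ, ENNReal.ofReal (g n x))

/-- The cost `∑ₙ ψ(n) ‖gₙ‖_∞ φ(‖gₙ‖₁/‖gₙ‖_∞)` of a decomposition (index shifted by 1;
`0/0 = 0` by the `ℝ≥0∞` division convention, and `φ 0 = 0`). -/
def seqCost (φ ψ : ℝ → ℝ) (g : ℕ → ℝ → ℝ) : ℝ≥0∞ :=
  ∑' n : ℕ, ENNReal.ofReal
    (ψ ((n : ℝ) + 1) * (eLpNorm (g n) ⊤ μ01).toReal *
      φ ((eLpNorm (g n) 1 μ01 / eLpNorm (g n) ⊤ μ01).toReal))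

/-- The quasi-norm `‖f‖_{φ,ψ}` (equal to `∞` when no admissible decomposition exists). -/
def QANorm (φ ψ : ℝ → ℝ) (f : ℝ → ℝ) : ℝ≥0∞ :=
  ⨅ (g : ℕ → ℝ → ℝ) (_ : Admissible f g), seqCost φ ψ g

/-- Membership in the space `QA_{φ,ψ}`. -/
def MemQA (φ ψ : ℝ → ℝ) (f : ℝ → ℝ) : Prop :=
  AEMeasurable f μ01 ∧ QANorm φ ψ f < ⊤

/-- The decreasing rearrangement `f*` of `f` on `[0,1]`. -/
def decRearr (f : ℝ → ℝ) (t : ℝ) : ℝ :=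
  sInf {s : ℝ | 0 ≤ s ∧ μ01 {x | s < |f x|} ≤ ENNReal.ofReal t}

/-- The limit `ζ(0⁺)` of a non-decreasing function `ζ` on `[0,1]`. -/
def limZero (ζ : ℝ → ℝ) : ℝ := sInf (ζ '' Set.Ioc 0 1)

/-- The Lorentz norm `‖f‖_{Λ_ζ} = ∫₀¹ f* dζ = ‖f‖_∞ ζ(0⁺) + ∫₀¹ f*(s) ζ'(s) ds`
(for `ζ` concave the derivative exists a.e. and `ζ` is absolutely continuous on `(0,1]`). -/
def lorentzNorm (ζ : ℝ → ℝ) (f : ℝ → ℝ) : ℝ≥0∞ :=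
  eLpNorm f ⊤ μ01 * ENNReal.ofReal (limZero ζ) +
    ∫⁻ s in Set.Ioc (0:ℝ) 1, ENNReal.ofReal (decRearr f s * deriv ζ s)

/-- Membership in the Lorentz space `Λ_ζ`. -/
def MemLorentz (ζ : ℝ → ℝ) (f : ℝ → ℝ) : Prop :=
  AEMeasurable f μ01 ∧ lorentzNorm ζ f < ⊤

/-- The quasi-concave function `φ_s(t) = inf_n max{sₙ,t} (φ(sₙ)/sₙ) ψ(n)` (index shifted by 1). -/
def phiSeq (φ ψ : ℝ → ℝ) (s : ℕ → ℝ) (t : ℝ) : ℝ :=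
  if t = 0 then 0 else ⨅ n : ℕ, max (s n) t * (φ (s n) / s n) * ψ ((n : ℝ) + 1)

/-- The function `τ(t) = φ(t) ψ(logbar(φ(t)/t))` with `logbar t = 1 + log⁺ t`. -/
def tauF (φ ψ : ℝ → ℝ) (t : ℝ) : ℝ :=
  if t = 0 then 0 else φ t * ψ (1 + max (Real.log (φ t / t)) 0)


lemma phi_nonneg {φ : ℝ → ℝ} (hφ : IsPhi φ) {t : ℝ} (h0 : 0 ≤ t) (h1 : t ≤ 1) : 0 ≤ φ t := by
  rcases h0.eq_or_lt with h | h
  · rw [← h, hφ.zero]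
  · exact (hφ.pos t h h1).le

lemma phi_star {φ : ℝ → ℝ} (hφ : IsPhi φ) {x y : ℝ} (hx : 0 ≤ x) (hxy : x ≤ y) (hy : y ≤ 1) :
    x * φ y ≤ y * φ x := by
  rcases (hx.trans hxy).eq_or_lt with h | h
  · have : x = 0 := le_antisymm (h ▸ hxy) hx
    rw [this, ← h]
  · have h00 : (0:ℝ) ∈ Icc (0:ℝ) 1 := by simp
    have hyy : y ∈ Icc (0:ℝ) 1 := ⟨h.le, hy⟩
    have ha : 0 ≤ 1 - x / y := by rw [sub_nonneg, div_le_one h]; exact hxy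
    have hb : 0 ≤ x / y := by positivity
    have := hφ.concave.2 h00 hyy ha hb (by ring)
    simp only [smul_eq_mul, mul_zero, hφ.zero, zero_add] at this
    rw [div_mul_cancel₀ _ h.ne'] at this
    have h2 := mul_le_mul_of_nonneg_left this h.le
    calc x * φ y = y * (x / y * φ y) := by field_simp
      _ ≤ _ := h2

lemma phi_lip {φ : ℝ → ℝ} (hφ : IsPhi φ) {a x y : ℝ} (ha : 0 < a) (hax : a ≤ x) (hxy : x ≤ y)
    (hy : y ≤ 1) : φ y - φ x ≤ φ a / a * (y - x) := by
  have hx : 0 < x := ha.trans_le hax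
  have h1 := phi_star hφ hx.le hxy hy
  have h2 := phi_star hφ ha.le hax (hxy.trans hy)
  have h3 : φ x / x ≤ φ a / a := by
    rw [div_le_div_iff₀ hx ha]; linarith
  have h4 : φ y - φ x ≤ φ x / x * (y - x) := by
    have : φ x / x * (y - x) = (y * φ x) / x - φ x := by field_simp
    rw [this]
    have : φ y ≤ (y * φ x) / x := by rw [le_div_iff₀ hx]; linarith
    linarith
  exact h4.trans (mul_le_mul_of_nonneg_right h3 (by linarith))

lemma phi_ac {φ : ℝ → ℝ} (hφ : IsPhi φ) {a b : ℝ} (ha : 0 < a) (hab : a ≤ b) (hb : b ≤ 1) :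
    AbsolutelyContinuousOnInterval φ a b := by
  have : LipschitzOnWith (φ a / a).toNNReal φ (uIcc a b) := by
    rw [uIcc_of_le hab]
    have hc : 0 ≤ φ a / a := div_nonneg (phi_nonneg hφ ha.le (hab.trans hb)) ha.le
    have key : ∀ x ∈ Icc a b, ∀ y ∈ Icc a b, x ≤ y → dist (φ x) (φ y) ≤ (φ a / a) * dist x y := by
      intro x hx y hy hxy
      rw [Real.dist_eq, Real.dist_eq, abs_sub_comm, abs_sub_comm x, abs_of_nonneg, abs_of_nonneg]
      · exact phi_lip hφ ha hx.1 hxy (hy.2.trans hb)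
      · linarith
      · have := hφ.mono ⟨by linarith [hx.1], by linarith [hx.2]⟩
          ⟨by linarith [hy.1], by linarith [hy.2]⟩ hxy
        linarith
    refine LipschitzOnWith.of_dist_le_mul fun x hx y hy => ?_
    rw [Real.coe_toNNReal _ hc]
    rcases le_total x y with h | h
    · exact key x hx y hy h
    · rw [dist_comm, dist_comm x]; exact key y hy x hx h
  exact this.absolutelyContinuousOnInterval

/-- a.e. differentiability on `(0,1)`. -/
lemma phi_ae_diff {φ : ℝ → ℝ} (hφ : IsPhi φ) :
    ∀ᵐ x ∂(volume.restrict (Ioc (0:ℝ) 1)), x ∈ Ioo (0:ℝ) 1 ∧ DifferentiableAt ℝ φ x := by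
  have h1 : ∀ n : ℕ, ∀ᵐ x : ℝ, x ∈ uIcc (1 / ((n:ℝ) + 1)) 1 → DifferentiableAt ℝ φ x := fun n =>
    (phi_ac hφ (a := 1 / ((n:ℝ) + 1)) (b := 1) (by positivity)
      (by rw [div_le_one (by positivity)]; linarith [Nat.cast_nonneg (α := ℝ) n]) le_rfl).ae_differentiableAt
  rw [← ae_all_iff] at h1
  rw [ae_restrict_iff' measurableSet_Ioc]
  have h2 : ∀ᵐ x : ℝ, x ≠ 1 := by simp [ae_iff]
  filter_upwards [h1, h2] with x hx hx1 hx2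
  refine ⟨⟨hx2.1, lt_of_le_of_ne hx2.2 hx1⟩, ?_⟩
  obtain ⟨n, hn⟩ := exists_nat_one_div_lt hx2.1
  apply hx n
  rw [uIcc_of_le (hn.le.trans hx2.2)]
  exact ⟨hn.le, hx2.2⟩

lemma phi_deriv_nonneg {φ : ℝ → ℝ} (hφ : IsPhi φ) {x : ℝ} (hx : x ∈ Ioo (0:ℝ) 1) :
    0 ≤ deriv φ x := by
  have := hφ.mono.derivWithin_nonneg (x := x)
  rwa [derivWithin_of_mem_nhds (Icc_mem_nhds hx.1 hx.2)] at this

lemma phi_deriv_anti {φ : ℝ → ℝ} (hφ : IsPhi φ) {x y : ℝ} (hx : x ∈ Ioo (0:ℝ) 1)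
    (hy : y ∈ Ioo (0:ℝ) 1) (hdx : DifferentiableAt ℝ φ x) (hdy : DifferentiableAt ℝ φ y)
    (hxy : x ≤ y) : deriv φ y ≤ deriv φ x := by
  rcases hxy.eq_or_lt with h | h
  · rw [h]
  · exact (hφ.concave.deriv_le_slope (Ioo_subset_Icc_self hx) (Ioo_subset_Icc_self hy) h hdy).trans
      (hφ.concave.slope_le_deriv (Ioo_subset_Icc_self hx) (Ioo_subset_Icc_self hy) h hdx)

/-- FTC away from zero. -/
lemma phi_ftc {φ : ℝ → ℝ} (hφ : IsPhi φ) {a b : ℝ} (ha : 0 < a) (hab : a ≤ b) (hb : b ≤ 1) :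
    ∫⁻ u in Ioc a b, ENNReal.ofReal (deriv φ u) = ENNReal.ofReal (φ b - φ a) := by
  have hac := phi_ac hφ ha hab hb
  rw [← hac.integral_deriv_eq_sub, intervalIntegral.integral_of_le hab]
  rw [ofReal_integral_eq_lintegral_ofReal]
  · exact (intervalIntegrable_iff_integrableOn_Ioc_of_le hab).1 hac.intervalIntegrable_deriv
  · have : ∀ᵐ x ∂(volume.restrict (Ioc (0:ℝ) 1)), 0 ≤ deriv φ x := by
      filter_upwards [phi_ae_diff hφ] with x hx using phi_deriv_nonneg hφ hx.1
    exact ae_restrict_of_ae_restrict_of_subset (Ioc_subset_Ioc ha.le hb) this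

lemma limZero_nonneg {φ : ℝ → ℝ} (hφ : IsPhi φ) : 0 ≤ limZero φ := by
  apply Real.sInf_nonneg
  rintro _ ⟨t, ht, rfl⟩
  exact (hφ.pos t ht.1 ht.2).le

lemma limZero_le {φ : ℝ → ℝ} (hφ : IsPhi φ) {t : ℝ} (h0 : 0 < t) (h1 : t ≤ 1) :
    limZero φ ≤ φ t := by
  refine csInf_le ⟨0, ?_⟩ ⟨t, ⟨h0, h1⟩, rfl⟩
  rintro _ ⟨t, ht, rfl⟩
  exact (hφ.pos t ht.1 ht.2).le

lemma limZero_tendsto {φ : ℝ → ℝ} (hφ : IsPhi φ) {t : ℝ} (h0 : 0 < t) (h1 : t ≤ 1) :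
    Tendsto (fun n : ℕ => φ (t / ((n:ℝ) + 1))) atTop (𝓝 (limZero φ)) := by
  have hm : ∀ n : ℕ, t / ((n:ℝ) + 1) ∈ Ioc (0:ℝ) 1 := fun n => ⟨by positivity, by
    rw [div_le_one (by positivity)]; linarith [Nat.cast_nonneg (α := ℝ) n]⟩
  rw [Metric.tendsto_atTop]
  intro ε hε
  obtain ⟨_, ⟨s, hs, rfl⟩, hse⟩ := exists_lt_of_csInf_lt (s := φ '' Ioc 0 1)
    ⟨φ 1, 1, by simp, rfl⟩ (b := limZero φ + ε) (by unfold limZero; linarith)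
  obtain ⟨N, hN⟩ := exists_nat_gt (t / s)
  refine ⟨N, fun n hn => ?_⟩
  have h2 : t / ((n:ℝ) + 1) ≤ s := by
    have : (N:ℝ) ≤ n := by exact_mod_cast hn
    rw [div_le_iff₀ (by positivity)]
    rw [div_lt_iff₀ hs.1] at hN
    nlinarith [hs.1]
  have h3 := hφ.mono (Ioc_subset_Icc_self (hm n)) (Ioc_subset_Icc_self hs) h2
  have h4 := limZero_le hφ (hm n).1 (hm n).2
  rw [Real.dist_eq, abs_of_nonneg (by linarith)]
  linarith

lemma phi_ftc0 {φ : ℝ → ℝ} (hφ : IsPhi φ) {t : ℝ} (h0 : 0 < t) (h1 : t ≤ 1) :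
    ENNReal.ofReal (limZero φ) + ∫⁻ u in Ioc 0 t, ENNReal.ofReal (deriv φ u)
      = ENNReal.ofReal (φ t) := by
  have hU : Ioc 0 t = ⋃ n : ℕ, Ioc (t / ((n:ℝ) + 1)) t := by
    ext x
    simp only [mem_Ioc, mem_iUnion]
    constructor
    · rintro ⟨hx0, hxt⟩
      obtain ⟨n, hn⟩ := exists_nat_gt (t / x)
      refine ⟨n, ?_, hxt⟩
      rw [div_lt_iff₀ hx0] at hn
      rw [div_lt_iff₀ (by positivity)]
      nlinarith
    · rintro ⟨n, hn, hxt⟩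
      exact ⟨lt_trans (by positivity) hn, hxt⟩
  have hmono : Monotone fun n : ℕ => Ioc (t / ((n:ℝ) + 1)) t := by
    intro m n hmn
    have : (m:ℝ) ≤ n := by exact_mod_cast hmn
    apply Ioc_subset_Ioc_left
    gcongr
  have hlim := tendsto_measure_iUnion_atTop (μ := volume.withDensity fun u => ENNReal.ofReal (deriv φ u)) hmono
  rw [← hU] at hlim
  have heq : ∀ n : ℕ, (volume.withDensity fun u => ENNReal.ofReal (deriv φ u)) (Ioc (t / ((n:ℝ) + 1)) t)
      = ENNReal.ofReal (φ t - φ (t / ((n:ℝ) + 1))) := by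
    intro n
    rw [withDensity_apply _ measurableSet_Ioc, phi_ftc hφ (by positivity) ?_ h1]
    rw [div_le_iff₀ (by positivity)]
    nlinarith [Nat.cast_nonneg (α := ℝ) n]
  have hlim2 : Tendsto (fun n : ℕ => ENNReal.ofReal (φ t - φ (t / ((n:ℝ) + 1)))) atTop
      (𝓝 (ENNReal.ofReal (φ t - limZero φ))) :=
    ENNReal.tendsto_ofReal ((limZero_tendsto hφ h0 h1).const_sub _)
  have := tendsto_nhds_unique hlim (hlim2.congr fun n => (heq n).symm)
  rw [withDensity_apply _ measurableSet_Ioc] at this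
  rw [this, ← ENNReal.ofReal_add (limZero_nonneg hφ) (by linarith [limZero_le hφ h0 h1])]
  congr 1; ring

instance : IsProbabilityMeasure μ01 := ⟨by simp [μ01]⟩

lemma dist_mono (f : ℝ → ℝ) {s t : ℝ} (h : s ≤ t) :
    μ01 {x | t < |f x|} ≤ μ01 {x | s < |f x|} :=
  measure_mono fun _ hx => lt_of_le_of_lt h hx

lemma dist_tendsto {f : ℝ → ℝ} (hf : AEMeasurable f μ01) :
    Tendsto (fun n : ℕ => μ01 {x | (n:ℝ) < |f x|}) atTop (𝓝 0) := by
  have h := tendsto_measure_iInter_atTop (μ := μ01) (s := fun n : ℕ => {x | (n:ℝ) < |f x|})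
    (fun n => nullMeasurableSet_lt aemeasurable_const hf.abs)
    (fun m n hmn x (hx : (n:ℝ) < |f x|) => by
      have h : (m:ℝ) ≤ n := by exact_mod_cast hmn
      exact lt_of_le_of_lt h hx) ⟨0, measure_ne_top _ _⟩
  have : (⋂ n : ℕ, {x | (n:ℝ) < |f x|}) = ∅ := by
    ext x
    simp only [mem_iInter, mem_ofPred_eq, mem_empty_iff_false, iff_false, not_forall, not_lt]
    obtain ⟨n, hn⟩ := exists_nat_ge |f x|
    exact ⟨n, hn⟩
  rwa [this, measure_empty] at h

lemma decRearr_nonneg (f : ℝ → ℝ) (u : ℝ) : 0 ≤ decRearr f u :=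
  Real.sInf_nonneg fun _ hs => hs.1

lemma decRearr_set_nonempty {f : ℝ → ℝ} (hf : AEMeasurable f μ01) {u : ℝ} (hu : 0 < u) :
    {s : ℝ | 0 ≤ s ∧ μ01 {x | s < |f x|} ≤ ENNReal.ofReal u}.Nonempty := by
  have := (dist_tendsto hf).eventually_le_const (u := ENNReal.ofReal u) (by simpa using hu)
  obtain ⟨n, hn⟩ := this.exists
  exact ⟨n, by positivity, hn⟩

lemma lt_decRearr_iff {f : ℝ → ℝ} (hf : AEMeasurable f μ01) {u s : ℝ} (hu : 0 < u) (hs : 0 ≤ s) :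
    s < decRearr f u ↔ ENNReal.ofReal u < μ01 {x | s < |f x|} := by
  have hb : BddBelow {s : ℝ | 0 ≤ s ∧ μ01 {x | s < |f x|} ≤ ENNReal.ofReal u} :=
    ⟨0, fun _ h => h.1⟩
  rw [← not_iff_not, not_lt, not_lt]
  constructor
  · intro h
    have hU : {x | s < |f x|} = ⋃ n : ℕ, {x | s + 1 / ((n:ℝ) + 1) < |f x|} := by
      ext x
      simp only [mem_ofPred_eq, mem_iUnion]
      constructor
      · intro hx
        obtain ⟨n, hn⟩ := exists_nat_one_div_lt (sub_pos.2 hx)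
        exact ⟨n, by linarith⟩
      · rintro ⟨n, hn⟩
        have : 0 < 1 / ((n:ℝ) + 1) := by positivity
        linarith
    have hmono : Monotone fun n : ℕ => {x | s + 1 / ((n:ℝ) + 1) < |f x|} := by
      intro m n hmn x hx
      have : (m:ℝ) ≤ n := by exact_mod_cast hmn
      have hx' : s + 1 / ((m:ℝ) + 1) < |f x| := hx
      change s + 1 / ((n:ℝ) + 1) < |f x|
      refine lt_of_le_of_lt ?_ hx'
      gcongr
    rw [hU, hmono.measure_iUnion]
    refine iSup_le fun n => ?_
    have : decRearr f u < s + 1 / ((n:ℝ) + 1) := by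
      have : 0 < 1 / ((n:ℝ) + 1) := by positivity
      linarith
    obtain ⟨s', hs', hlt⟩ := exists_lt_of_csInf_lt (decRearr_set_nonempty hf hu) this
    exact (dist_mono f hlt.le).trans hs'.2
  · intro h
    exact csInf_le hb ⟨hs, h⟩

lemma decRearr_anti {f : ℝ → ℝ} (hf : AEMeasurable f μ01) : AntitoneOn (decRearr f) (Ioi 0) := by
  intro u hu v hv huv
  by_contra! h
  rw [lt_decRearr_iff hf hv (decRearr_nonneg _ _)] at h
  have := lt_of_le_of_lt (ENNReal.ofReal_le_ofReal huv) h
  rw [← lt_decRearr_iff hf hu (decRearr_nonneg _ _)] at this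
  exact lt_irrefl _ this

lemma decRearr_aem {f : ℝ → ℝ} (hf : AEMeasurable f μ01) :
    AEMeasurable (decRearr f) (volume.restrict (Ioc (0:ℝ) 1)) :=
  aemeasurable_restrict_of_antitoneOn measurableSet_Ioc
    ((decRearr_anti hf).mono fun _ hx => hx.1)

/-- layer cake for the rearrangement against a general measure -/
lemma layer {f : ℝ → ℝ} (hf : AEMeasurable f μ01) (ν : Measure ℝ)
    (hν : ν ≪ volume.restrict (Ioc (0:ℝ) 1)) :
    ∫⁻ u, ENNReal.ofReal (decRearr f u) ∂ν
      = ∫⁻ s in Ioi (0:ℝ), ν (Ioo 0 (μ01 {x | s < |f x|}).toReal) := by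
  rw [lintegral_eq_lintegral_meas_lt ν (Eventually.of_forall fun u => decRearr_nonneg f u)
    ((decRearr_aem hf).mono_ac hν)]
  refine setLIntegral_congr_fun measurableSet_Ioi fun s hs => ?_
  apply measure_congr
  have h0 : ∀ᵐ u ∂ν, u ∈ Ioc (0:ℝ) 1 := hν.ae_le (ae_restrict_mem measurableSet_Ioc)
  filter_upwards [h0] with u hu
  apply propext
  change s < decRearr f u ↔ 0 < u ∧ u < _
  rw [lt_decRearr_iff hf hu.1 (le_of_lt hs), ENNReal.ofReal_lt_iff_lt_toReal hu.1.le (measure_ne_top _ _)]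
  simp [hu.1]

lemma dist_toReal_le (f : ℝ → ℝ) (s : ℝ) : (μ01 {x | s < |f x|}).toReal ≤ 1 := by
  have : μ01 {x | s < |f x|} ≤ 1 := prob_le_one
  simpa using ENNReal.toReal_mono one_ne_top this

lemma ofReal_lt_eLpNorm_iff (f : ℝ → ℝ) {s : ℝ} (hs : 0 ≤ s) :
    ENNReal.ofReal s < eLpNorm f ⊤ μ01 ↔ 0 < μ01 {x | s < |f x|} := by
  rw [← not_iff_not, not_lt, not_lt, eLpNorm_exponent_top, nonpos_iff_eq_zero]
  have key : (∀ᵐ x ∂μ01, ‖f x‖ₑ ≤ ENNReal.ofReal s) ↔ μ01 {x | s < |f x|} = 0 := by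
    rw [ae_iff]
    have : {a | ¬ ‖f a‖ₑ ≤ ENNReal.ofReal s} = {x | s < |f x|} := by
      ext x
      simp only [mem_ofPred_eq, not_le]
      rw [Real.enorm_eq_ofReal_abs, ENNReal.ofReal_lt_ofReal_iff_of_nonneg hs]
    rw [this]
  rw [← key]
  exact ⟨fun h => (enorm_ae_le_eLpNormEssSup f μ01).mono fun x hx => hx.trans h,
    fun h => essSup_le_of_ae_le _ h⟩

lemma vol_lt (E : ℝ≥0∞) : volume {s : ℝ | 0 < s ∧ ENNReal.ofReal s < E} = E := by
  rcases eq_or_ne E ⊤ with rfl | h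
  · have : {s : ℝ | 0 < s ∧ ENNReal.ofReal s < ⊤} = Ioi 0 := by ext; simp
    rw [this, Real.volume_Ioi]
  · have : {s : ℝ | 0 < s ∧ ENNReal.ofReal s < E} = Ioo 0 E.toReal := by
      ext s
      simp only [mem_ofPred_eq, mem_Ioo]
      refine and_congr_right fun hs => ?_
      rw [ENNReal.ofReal_lt_iff_lt_toReal hs.le h]
    rw [this, Real.volume_Ioo, sub_zero, ENNReal.ofReal_toReal h]

lemma lorentz_eq {φ : ℝ → ℝ} (hφ : IsPhi φ) {f : ℝ → ℝ} (hf : AEMeasurable f μ01) :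
    lorentzNorm φ f
      = ∫⁻ s in Ioi (0:ℝ), ENNReal.ofReal (φ (μ01 {x | s < |f x|}).toReal) := by
  unfold lorentzNorm
  have hw : Measurable fun u => ENNReal.ofReal (deriv φ u) :=
    (measurable_deriv φ).ennreal_ofReal
  have h1 : ∫⁻ s in Ioc (0:ℝ) 1, ENNReal.ofReal (decRearr f s * deriv φ s)
      = ∫⁻ s in Ioi (0:ℝ), ∫⁻ u in Ioc 0 (μ01 {x | s < |f x|}).toReal,
        ENNReal.ofReal (deriv φ u) := by
    set ν := (volume.restrict (Ioc (0:ℝ) 1)).withDensity fun u => ENNReal.ofReal (deriv φ u)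
    have hac : ν ≪ volume.restrict (Ioc (0:ℝ) 1) := withDensity_absolutelyContinuous _ _
    have h2 : ∫⁻ s in Ioc (0:ℝ) 1, ENNReal.ofReal (decRearr f s * deriv φ s)
        = ∫⁻ u, ENNReal.ofReal (decRearr f u) ∂ν := by
      rw [lintegral_withDensity_eq_lintegral_mul₀ hw.aemeasurable (decRearr_aem hf).ennreal_ofReal]
      refine lintegral_congr fun u => ?_
      rw [ENNReal.ofReal_mul (decRearr_nonneg _ _), Pi.mul_apply, mul_comm]
    rw [h2, layer hf ν hac]
    refine lintegral_congr fun s => ?_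
    rw [withDensity_apply _ measurableSet_Ioo, Measure.restrict_restrict measurableSet_Ioo,
      restrict_Ioo_eq_restrict_Ioc.symm]
    congr 2
    ext u
    have := dist_toReal_le f s
    simp only [mem_inter_iff, mem_Ioo, mem_Ioc]
    constructor
    · rintro ⟨h, -⟩; exact h
    · intro h; exact ⟨h, h.1, by linarith [h.2]⟩
  have hset : MeasurableSet {s : ℝ | ENNReal.ofReal s < eLpNorm f ⊤ μ01} :=
    measurableSet_lt ENNReal.measurable_ofReal measurable_const
  have h3 : eLpNorm f ⊤ μ01 * ENNReal.ofReal (limZero φ)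
      = ∫⁻ s in Ioi (0:ℝ), {s : ℝ | ENNReal.ofReal s < eLpNorm f ⊤ μ01}.indicator
          (fun _ => ENNReal.ofReal (limZero φ)) s := by
    rw [lintegral_indicator hset, lintegral_const, Measure.restrict_restrict hset,
      Measure.restrict_apply_univ, mul_comm]
    congr 1
    refine (vol_lt (eLpNorm f ⊤ μ01)).symm.trans ?_
    congr 1
    ext s
    simp [and_comm]
  rw [h1, h3, ← lintegral_add_left (measurable_const.indicator hset)]
  refine setLIntegral_congr_fun measurableSet_Ioi fun s hs => ?_
  have hs' : 0 ≤ s := le_of_lt hs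
  simp only [indicator_apply, mem_ofPred_eq, ofReal_lt_eLpNorm_iff f hs']
  split_ifs with h
  · exact phi_ftc0 hφ (ENNReal.toReal_pos h.ne' (measure_ne_top _ _)) (dist_toReal_le f s)
  · have : μ01 {x | s < |f x|} = 0 := by simpa using h
    simp [this, hφ.zero]

lemma hardy {φ : ℝ → ℝ} (hφ : IsPhi φ) {F G : ℝ → ℝ≥0∞}
    (hF : AEMeasurable F (volume.restrict (Ioc (0:ℝ) 1)))
    (hG : AEMeasurable G (volume.restrict (Ioc (0:ℝ) 1)))
    (h : ∀ a : ℝ, 0 < a → a ≤ 1 → ∫⁻ u in Ioc 0 a, F u ≤ ∫⁻ u in Ioc 0 a, G u) :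
    ∫⁻ u in Ioc (0:ℝ) 1, F u * ENNReal.ofReal (deriv φ u)
      ≤ ∫⁻ u in Ioc (0:ℝ) 1, G u * ENNReal.ofReal (deriv φ u) := by
  have hw : Measurable fun u => ENNReal.ofReal (deriv φ u) :=
    (measurable_deriv φ).ennreal_ofReal
  have key : ∀ K : ℝ → ℝ≥0∞, AEMeasurable K (volume.restrict (Ioc (0:ℝ) 1)) →
      ∫⁻ u in Ioc (0:ℝ) 1, K u * ENNReal.ofReal (deriv φ u)
      = ∫⁻ y in Ioi (0:ℝ), ((volume.restrict (Ioc (0:ℝ) 1)).withDensity K) {u | y < deriv φ u} := by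
    intro K hK
    rw [← lintegral_eq_lintegral_meas_lt _ _ (measurable_deriv φ).aemeasurable]
    · rw [lintegral_withDensity_eq_lintegral_mul₀ hK hw.aemeasurable]
      rfl
    · refine (withDensity_absolutelyContinuous _ _).ae_le ?_
      filter_upwards [phi_ae_diff hφ] with x hx using phi_deriv_nonneg hφ hx.1
  rw [key F hF, key G hG]
  refine lintegral_mono fun y => ?_
  set S := {u | y < deriv φ u ∧ u ∈ Ioo (0:ℝ) 1 ∧ DifferentiableAt ℝ φ u} with hS
  rcases S.eq_empty_or_nonempty with hE | hne
  · have : (volume.restrict (Ioc (0:ℝ) 1)) {u | y < deriv φ u} = 0 := by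
      rw [measure_eq_zero_iff_ae_notMem]
      filter_upwards [phi_ae_diff hφ] with x hx hx'
      have : x ∈ S := ⟨hx', hx⟩
      rw [hE] at this; exact this
    rw [withDensity_absolutelyContinuous _ _ this]
    simp
  · have hbdd : BddAbove S := ⟨1, fun u hu => hu.2.1.2.le⟩
    set a := sSup S
    have ha0 : 0 < a := by
      obtain ⟨u, hu⟩ := hne
      exact hu.2.1.1.trans_le (le_csSup hbdd hu)
    have ha1 : a ≤ 1 := csSup_le hne fun u hu => hu.2.1.2.le
    have hae : {u | y < deriv φ u} =ᵐ[volume.restrict (Ioc (0:ℝ) 1)] Ioc 0 a := by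
      have hna : ∀ᵐ u ∂(volume.restrict (Ioc (0:ℝ) 1)), u ≠ a :=
        ae_restrict_of_ae (by simp [ae_iff])
      filter_upwards [phi_ae_diff hφ, hna] with u hu hua
      apply propext
      change y < deriv φ u ↔ 0 < u ∧ u ≤ a
      constructor
      · intro h; exact ⟨hu.1.1, le_csSup hbdd ⟨h, hu⟩⟩
      · rintro ⟨_, hle⟩
        obtain ⟨v, hv, huv⟩ := exists_lt_of_lt_csSup hne (lt_of_le_of_ne hle hua)
        exact hv.1.trans_le (phi_deriv_anti hφ hu.1 hv.2.1 hu.2 hv.2.2 huv.le)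
    have e : ∀ K : ℝ → ℝ≥0∞, ((volume.restrict (Ioc (0:ℝ) 1)).withDensity K) {u | y < deriv φ u}
        = ∫⁻ u in Ioc 0 a, K u := by
      intro K
      rw [measure_congr ((withDensity_absolutelyContinuous _ K).ae_eq hae),
        withDensity_apply _ measurableSet_Ioc, Measure.restrict_restrict measurableSet_Ioc,
        inter_eq_left.2 (Ioc_subset_Ioc_right ha1)]
    rw [e, e]
    exact h a ha0 ha1

lemma int_decRearr_le {f : ℝ → ℝ} (hf : AEMeasurable f μ01) {a : ℝ} (ha1 : a ≤ 1) :
    ∫⁻ u in Ioc 0 a, ENNReal.ofReal (decRearr f u) ≤ ∫⁻ x, ENNReal.ofReal |f x| ∂μ01 := by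
  rw [layer hf (volume.restrict (Ioc 0 a))
    (Measure.restrict_mono (Ioc_subset_Ioc_right ha1) le_rfl).absolutelyContinuous,
    lintegral_eq_lintegral_meas_lt μ01 (Eventually.of_forall fun x => abs_nonneg (f x)) hf.abs]
  refine lintegral_mono fun s => ?_
  refine (Measure.restrict_apply_le _ _).trans ?_
  rw [Real.volume_Ioo, sub_zero, ENNReal.ofReal_toReal (measure_ne_top _ _)]

lemma int_decRearr_le_add {f : ℝ → ℝ} (hf : AEMeasurable f μ01) {a c : ℝ} (ha1 : a ≤ 1)
    (hc : 0 ≤ c) {r : ℝ → ℝ≥0∞}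
    (h : ∀ᵐ x ∂μ01, ENNReal.ofReal |f x| ≤ ENNReal.ofReal c + r x) :
    ∫⁻ u in Ioc 0 a, ENNReal.ofReal (decRearr f u)
      ≤ ENNReal.ofReal c * ENNReal.ofReal a + ∫⁻ x, r x ∂μ01 := by
  set g : ℝ → ℝ := fun x => max (|f x| - c) 0 with hg
  have hgm : AEMeasurable g μ01 := (hf.abs.sub_const c).max aemeasurable_const
  have hle : ∀ u ∈ Ioc 0 a, decRearr f u ≤ c + decRearr g u := by
    intro u hu
    have h0 := decRearr_nonneg g u
    rw [← not_lt, lt_decRearr_iff hf hu.1 (by positivity), not_lt]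
    have h1 : ¬ decRearr g u < decRearr g u := lt_irrefl _
    rw [lt_decRearr_iff hgm hu.1 h0, not_lt] at h1
    refine le_trans (measure_mono fun x hx => ?_) h1
    have hx' : c + decRearr g u < |f x| := hx
    change decRearr g u < |g x|
    refine lt_of_lt_of_le ?_ (le_abs_self _)
    exact lt_of_lt_of_le (by linarith) (le_max_left _ _)
  calc ∫⁻ u in Ioc 0 a, ENNReal.ofReal (decRearr f u)
      ≤ ∫⁻ u in Ioc 0 a, (ENNReal.ofReal c + ENNReal.ofReal (decRearr g u)) := by
        refine setLIntegral_mono' measurableSet_Ioc fun u hu => ?_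
        rw [← ENNReal.ofReal_add hc (decRearr_nonneg _ _)]
        exact ENNReal.ofReal_le_ofReal (hle u hu)
    _ = ENNReal.ofReal c * ENNReal.ofReal a + ∫⁻ u in Ioc 0 a, ENNReal.ofReal (decRearr g u) := by
        rw [lintegral_add_left measurable_const]
        simp
    _ ≤ _ := by
        refine add_le_add le_rfl ((int_decRearr_le hgm ha1).trans ?_)
        refine lintegral_mono_ae ?_
        filter_upwards [h] with x hx
        rw [abs_of_nonneg (le_max_right _ _), hg]
        simp only
        rw [ENNReal.ofReal_max, ENNReal.ofReal_zero, max_eq_left (by simp), ENNReal.ofReal_sub _ hc]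
        exact tsub_le_iff_left.2 hx

/-- the real ratio `‖g‖₁/‖g‖_∞`. -/
def ratio (g : ℝ → ℝ) : ℝ := (eLpNorm g 1 μ01 / eLpNorm g ⊤ μ01).toReal

lemma eLp1_le {g : ℝ → ℝ} (hg : AEMeasurable g μ01) : eLpNorm g 1 μ01 ≤ eLpNorm g ⊤ μ01 :=
  eLpNorm_le_eLpNorm_of_exponent_le le_top hg.aestronglyMeasurable

lemma ratio_div_le {g : ℝ → ℝ} (hg : AEMeasurable g μ01) :
    eLpNorm g 1 μ01 / eLpNorm g ⊤ μ01 ≤ 1 :=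
  ENNReal.div_le_of_le_mul (by simpa using eLp1_le hg)

lemma ratio_nonneg (g : ℝ → ℝ) : 0 ≤ ratio g := ENNReal.toReal_nonneg

lemma ratio_le_one {g : ℝ → ℝ} (hg : AEMeasurable g μ01) : ratio g ≤ 1 := by
  simpa [ratio] using ENNReal.toReal_mono one_ne_top (ratio_div_le hg)

lemma mul_ratio {g : ℝ → ℝ} (hg : AEMeasurable g μ01) (ht : eLpNorm g ⊤ μ01 < ⊤) :
    eLpNorm g ⊤ μ01 * ENNReal.ofReal (ratio g) = eLpNorm g 1 μ01 := by
  unfold ratio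
  rw [ENNReal.ofReal_toReal (ne_top_of_le_ne_top one_ne_top (ratio_div_le hg))]
  rcases eq_or_ne (eLpNorm g ⊤ μ01) 0 with h0 | h0
  · have := eLp1_le hg
    rw [h0] at this
    rw [h0, zero_mul]; exact (le_antisymm this (by simp)).symm
  · exact ENNReal.mul_div_cancel h0 ht.ne

lemma ratio_pos {g : ℝ → ℝ} (hg : AEMeasurable g μ01) (ht : eLpNorm g ⊤ μ01 < ⊤)
    (h0 : eLpNorm g ⊤ μ01 ≠ 0) : 0 < ratio g := by
  by_contra! h
  have h1 := mul_ratio hg ht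
  rw [ENNReal.ofReal_of_nonpos h, mul_zero] at h1
  have h2 := (eLpNorm_eq_zero_iff hg.aestronglyMeasurable (by simp)).1 h1.symm
  exact h0 ((eLpNorm_eq_zero_iff hg.aestronglyMeasurable (by simp)).2 h2)

lemma eLp1_eq {g : ℝ → ℝ} (h0 : ∀ x, 0 ≤ g x) :
    eLpNorm g 1 μ01 = ∫⁻ x, ENNReal.ofReal (g x) ∂μ01 := by
  rw [eLpNorm_one_eq_lintegral_enorm]
  refine lintegral_congr fun x => ?_
  rw [Real.enorm_eq_ofReal_abs, abs_of_nonneg (h0 x)]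

lemma ae_le_top {g : ℝ → ℝ} (h0 : ∀ x, 0 ≤ g x) :
    ∀ᵐ x ∂μ01, ENNReal.ofReal (g x) ≤ eLpNorm g ⊤ μ01 := by
  rw [eLpNorm_exponent_top]
  filter_upwards [enorm_ae_le_eLpNormEssSup g μ01] with x hx
  rwa [Real.enorm_eq_ofReal_abs, abs_of_nonneg (h0 x)] at hx

lemma Ka_le {f : ℝ → ℝ} (hf : AEMeasurable f μ01) {g : ℕ → ℝ → ℝ} (hg : Admissible f g)
    {a : ℝ} (ha0 : 0 < a) (ha1 : a ≤ 1) :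
    ∫⁻ u in Ioc 0 a, ENNReal.ofReal (decRearr f u)
      ≤ ∑' n, eLpNorm (g n) ⊤ μ01 * ENNReal.ofReal (min (ratio (g n)) a) := by
  obtain ⟨hm, ht, h0, hle⟩ := hg
  classical
  set c : ℝ≥0∞ := ∑' n, if a < ratio (g n) then eLpNorm (g n) ⊤ μ01 else 0 with hc
  set r : ℝ → ℝ≥0∞ := fun x => ∑' n, if a < ratio (g n) then 0 else ENNReal.ofReal (g n x) with hr
  have hsum : c * ENNReal.ofReal a + ∫⁻ x, r x ∂μ01
      = ∑' n, eLpNorm (g n) ⊤ μ01 * ENNReal.ofReal (min (ratio (g n)) a) := by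
    rw [hr, lintegral_tsum, hc, ← ENNReal.tsum_mul_right, ← ENNReal.tsum_add]
    · refine tsum_congr fun n => ?_
      split_ifs with h
      · simp [min_eq_right h.le]
      · rw [min_eq_left (not_lt.1 h), mul_ratio (hm n) (ht n), eLp1_eq (h0 n)]
        simp
    · intro n
      split_ifs
      · exact aemeasurable_const
      · exact (hm n).ennreal_ofReal
  rw [← hsum]
  rcases eq_or_ne c ⊤ with hct | hct
  · rw [hct, ENNReal.top_mul (by simpa using ha0)]
    simp
  · have := int_decRearr_le_add hf (a := a) (c := c.toReal) (r := r) ha1 ENNReal.toReal_nonneg ?_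
    · rwa [ENNReal.ofReal_toReal hct] at this
    · rw [ENNReal.ofReal_toReal hct]
      have h2 := ae_all_iff.2 fun n => ae_le_top (h0 n)
      filter_upwards [hle, h2] with x hx hx2
      refine hx.trans ?_
      rw [hr, hc, ← ENNReal.tsum_add]
      refine ENNReal.tsum_le_tsum fun n => ?_
      split_ifs
      · simpa using hx2 n
      · simp

lemma eLpTop_le {f : ℝ → ℝ} {g : ℕ → ℝ → ℝ} (hg : Admissible f g) :
    eLpNorm f ⊤ μ01 ≤ ∑' n, eLpNorm (g n) ⊤ μ01 := by
  obtain ⟨hm, ht, h0, hle⟩ := hg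
  rw [eLpNorm_exponent_top]
  refine essSup_le_of_ae_le _ ?_
  have h2 := ae_all_iff.2 fun n => ae_le_top (h0 n)
  filter_upwards [hle, h2] with x hx hx2
  rw [Real.enorm_eq_ofReal_abs]
  exact hx.trans (ENNReal.tsum_le_tsum hx2)

lemma lorentz_le_cost {φ : ℝ → ℝ} (hφ : IsPhi φ) {f : ℝ → ℝ} (hf : AEMeasurable f μ01)
    {g : ℕ → ℝ → ℝ} (hg : Admissible f g) :
    lorentzNorm φ f ≤ seqCost φ (fun _ => 1) g := by
  have hw : Measurable fun u => ENNReal.ofReal (deriv φ u) :=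
    (measurable_deriv φ).ennreal_ofReal
  set G : ℝ → ℝ≥0∞ := fun u => ∑' n, (Ioc 0 (ratio (g n))).indicator
    (fun _ => eLpNorm (g n) ⊤ μ01) u with hG
  have hGm1 : ∀ n, Measurable ((Ioc 0 (ratio (g n))).indicator
    (fun _ : ℝ => eLpNorm (g n) ⊤ μ01)) := fun n => measurable_const.indicator measurableSet_Ioc
  have hGm : Measurable G := Measurable.tsum hGm1
  have h1 : ∫⁻ s in Ioc (0:ℝ) 1, ENNReal.ofReal (decRearr f s * deriv φ s)
      ≤ ∑' n, eLpNorm (g n) ⊤ μ01 * ∫⁻ u in Ioc 0 (ratio (g n)), ENNReal.ofReal (deriv φ u) := by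
    calc ∫⁻ s in Ioc (0:ℝ) 1, ENNReal.ofReal (decRearr f s * deriv φ s)
        = ∫⁻ s in Ioc (0:ℝ) 1, ENNReal.ofReal (decRearr f s) * ENNReal.ofReal (deriv φ s) :=
          lintegral_congr fun u => ENNReal.ofReal_mul (decRearr_nonneg _ _)
      _ ≤ ∫⁻ s in Ioc (0:ℝ) 1, G s * ENNReal.ofReal (deriv φ s) := by
          refine hardy hφ (decRearr_aem hf).ennreal_ofReal hGm.aemeasurable fun a ha0 ha1 => ?_
          refine (Ka_le hf hg ha0 ha1).trans (le_of_eq ?_)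
          rw [hG, lintegral_tsum fun n => (hGm1 n).aemeasurable]
          refine tsum_congr fun n => ?_
          rw [lintegral_indicator measurableSet_Ioc, lintegral_const,
            Measure.restrict_restrict measurableSet_Ioc, Measure.restrict_apply_univ,
            Ioc_inter_Ioc, Real.volume_Ioc]
          simp
      _ = _ := by
          have : ∀ s, G s * ENNReal.ofReal (deriv φ s) = ∑' n, (Ioc 0 (ratio (g n))).indicator
              (fun s => eLpNorm (g n) ⊤ μ01 * ENNReal.ofReal (deriv φ s)) s := by
            intro s
            rw [hG, ← ENNReal.tsum_mul_right]
            refine tsum_congr fun n => ?_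
            by_cases h : s ∈ Ioc 0 (ratio (g n)) <;> simp [h]
          simp_rw [this]
          have hm2 : ∀ n, AEMeasurable ((Ioc 0 (ratio (g n))).indicator
              (fun s => eLpNorm (g n) ⊤ μ01 * ENNReal.ofReal (deriv φ s)))
              (volume.restrict (Ioc (0:ℝ) 1)) := fun n =>
            ((hw.const_mul _).indicator measurableSet_Ioc).aemeasurable
          rw [lintegral_tsum hm2]
          refine tsum_congr fun n => ?_
          rw [lintegral_indicator measurableSet_Ioc, lintegral_const_mul _ hw,
            Measure.restrict_restrict measurableSet_Ioc,
            inter_eq_left.2 (Ioc_subset_Ioc_right (ratio_le_one (hg.1 n)))]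
  unfold lorentzNorm
  calc _ ≤ (∑' n, eLpNorm (g n) ⊤ μ01) * ENNReal.ofReal (limZero φ) +
        ∑' n, eLpNorm (g n) ⊤ μ01 * ∫⁻ u in Ioc 0 (ratio (g n)), ENNReal.ofReal (deriv φ u) := by
        gcongr
        exact eLpTop_le hg
    _ = seqCost φ (fun _ => 1) g := by
        rw [← ENNReal.tsum_mul_right, ← ENNReal.tsum_add]
        unfold seqCost
        refine tsum_congr fun n => ?_
        rw [← mul_add, one_mul]
        rcases eq_or_ne (eLpNorm (g n) ⊤ μ01) 0 with h0 | h0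
        · simp [h0]
        · rw [phi_ftc0 hφ (ratio_pos (hg.1 n) (hg.2.1 n) h0) (ratio_le_one (hg.1 n)),
            ENNReal.ofReal_mul ENNReal.toReal_nonneg, ENNReal.ofReal_toReal (hg.2.1 n).ne]
          rfl

lemma seqCost_smul (φ ψ : ℝ → ℝ) (g : ℕ → ℝ → ℝ) {c : ℝ} (hc : 0 < c) :
    seqCost φ ψ (fun n => c • g n) = ENNReal.ofReal c * seqCost φ ψ g := by
  unfold seqCost
  rw [← ENNReal.tsum_mul_left]
  refine tsum_congr fun n => ?_
  rw [eLpNorm_const_smul, eLpNorm_const_smul, Real.enorm_eq_ofReal hc.le,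
    ENNReal.mul_div_mul_left _ _ (by simpa using hc) ENNReal.ofReal_ne_top, ENNReal.toReal_mul,
    ENNReal.toReal_ofReal hc.le, ← ENNReal.ofReal_mul hc.le]
  congr 1; ring

lemma Admissible.smul {f : ℝ → ℝ} {g : ℕ → ℝ → ℝ} (h : Admissible f g) {c : ℝ} (hc : 0 < c) :
    Admissible (c • f) (fun n => c • g n) := by
  obtain ⟨hm, ht, h0, hle⟩ := h
  refine ⟨fun n => (hm n).const_smul c, fun n => ?_, fun n x => ?_, ?_⟩
  · rw [eLpNorm_const_smul]
    exact ENNReal.mul_lt_top (by simp) (ht n)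
  · exact mul_nonneg hc.le (h0 n x)
  · filter_upwards [hle] with x hx
    simp only [Pi.smul_apply, smul_eq_mul]
    rw [abs_mul, abs_of_pos hc, ENNReal.ofReal_mul hc.le]
    simp_rw [ENNReal.ofReal_mul hc.le]
    rw [ENNReal.tsum_mul_left]
    gcongr

lemma interleave_tsum (a b : ℕ → ℝ≥0∞) (c : ℕ → ℝ≥0∞) (h0 : ∀ k, c (2 * k) = a k)
    (h1 : ∀ k, c (2 * k + 1) = b k) : ∑' n, c n = ∑' n, a n + ∑' n, b n := by
  rw [← tsum_even_add_odd ENNReal.summable ENNReal.summable]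
  simp_rw [h0, h1]

/-- interleaving of two sequences of functions -/
def inter2 (a b : ℕ → ℝ → ℝ) (n : ℕ) : ℝ → ℝ := if n % 2 = 0 then a (n / 2) else b (n / 2)

lemma inter2_even (a b : ℕ → ℝ → ℝ) (k : ℕ) : inter2 a b (2 * k) = a k := by
  simp [inter2]

lemma inter2_odd (a b : ℕ → ℝ → ℝ) (k : ℕ) : inter2 a b (2 * k + 1) = b k := by
  have h1 : (2 * k + 1) % 2 = 1 := by omega
  have h2 : (2 * k + 1) / 2 = k := by omega
  simp [inter2, h1, h2]

lemma Admissible.inter {f g : ℝ → ℝ} {a b : ℕ → ℝ → ℝ} (hf : Admissible f a)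
    (hg : Admissible g b) : Admissible (f + g) (inter2 a b) := by
  refine ⟨fun n => ?_, fun n => ?_, fun n x => ?_, ?_⟩
  · unfold inter2; split_ifs
    · exact hf.1 _
    · exact hg.1 _
  · unfold inter2; split_ifs
    · exact hf.2.1 _
    · exact hg.2.1 _
  · unfold inter2; split_ifs
    · exact hf.2.2.1 _ _
    · exact hg.2.2.1 _ _
  · filter_upwards [hf.2.2.2, hg.2.2.2] with x hx hy
    rw [interleave_tsum (fun n => ENNReal.ofReal (a n x)) (fun n => ENNReal.ofReal (b n x))
      _ (fun k => by rw [inter2_even]) (fun k => by rw [inter2_odd])]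
    refine le_trans ?_ (add_le_add hx hy)
    rw [← ENNReal.ofReal_add (abs_nonneg _) (abs_nonneg _)]
    exact ENNReal.ofReal_le_ofReal (abs_add_le _ _)

lemma seqCost_inter (φ : ℝ → ℝ) (a b : ℕ → ℝ → ℝ) :
    seqCost φ (fun _ => 1) (inter2 a b) = seqCost φ (fun _ => 1) a + seqCost φ (fun _ => 1) b := by
  unfold seqCost
  exact interleave_tsum _ _ _ (fun k => by rw [inter2_even]) (fun k => by rw [inter2_odd])

lemma exists_adm {φ ψ : ℝ → ℝ} {f : ℝ → ℝ} {r : ℝ≥0∞} (h : QANorm φ ψ f < r) :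
    ∃ g, Admissible f g ∧ seqCost φ ψ g < r := by
  unfold QANorm at h
  rw [iInf_lt_iff] at h
  obtain ⟨g, hg⟩ := h
  rw [iInf_lt_iff] at hg
  obtain ⟨h1, h2⟩ := hg
  exact ⟨g, h1, h2⟩

lemma QANorm_le {φ ψ : ℝ → ℝ} {f : ℝ → ℝ} {g : ℕ → ℝ → ℝ} (h : Admissible f g) :
    QANorm φ ψ f ≤ seqCost φ ψ g := iInf₂_le g h

lemma convex_N1 (φ : ℝ → ℝ) (K : ℝ≥0∞) :
    Convex ℝ {f : ℝ → ℝ | AEMeasurable f μ01 ∧ QANorm φ (fun _ => 1) f ≤ K} := by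
  rw [convex_iff_forall_pos]
  rintro f ⟨hfm, hf⟩ g ⟨hgm, hg⟩ α β hα hβ hαβ
  refine ⟨(hfm.const_smul α).add (hgm.const_smul β), ?_⟩
  refine le_of_forall_gt fun K' hK' => ?_
  obtain ⟨K'', hK1, hK2⟩ := exists_between hK'
  obtain ⟨a, ha, ha'⟩ := exists_adm (lt_of_le_of_lt hf hK1)
  obtain ⟨b, hb, hb'⟩ := exists_adm (lt_of_le_of_lt hg hK1)
  refine lt_of_le_of_lt (QANorm_le ((ha.smul hα).inter (hb.smul hβ))) ?_
  rw [seqCost_inter, seqCost_smul _ _ _ hα, seqCost_smul _ _ _ hβ]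
  calc _ ≤ ENNReal.ofReal α * K'' + ENNReal.ofReal β * K'' := by gcongr
    _ = K'' := by
      rw [← add_mul, ← ENNReal.ofReal_add hα.le hβ.le, hαβ, ENNReal.ofReal_one, one_mul]
    _ < K' := hK2

lemma lorentz_le_N1 {φ : ℝ → ℝ} (hφ : IsPhi φ) {f : ℝ → ℝ} (hf : AEMeasurable f μ01) :
    lorentzNorm φ f ≤ QANorm φ (fun _ => 1) f :=
  le_iInf₂ fun _ hg => lorentz_le_cost hφ hf hg

lemma cost_one_le {φ ψ : ℝ → ℝ} (hφ : IsPhi φ) (hψ : IsPsi ψ) {g : ℕ → ℝ → ℝ}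
    (hg : ∀ n, AEMeasurable (g n) μ01) :
    ENNReal.ofReal (ψ 1) * seqCost φ (fun _ => 1) g ≤ seqCost φ ψ g := by
  unfold seqCost
  rw [← ENNReal.tsum_mul_left]
  refine ENNReal.tsum_le_tsum fun n => ?_
  rw [← ENNReal.ofReal_mul (hψ.pos 1 one_pos).le]
  apply ENNReal.ofReal_le_ofReal
  have h1 : ψ 1 ≤ ψ ((n:ℝ) + 1) := hψ.mono (by simp) (by simp; positivity) (by simp)
  have h2 : 0 ≤ φ ((eLpNorm (g n) 1 μ01 / eLpNorm (g n) ⊤ μ01).toReal) :=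
    phi_nonneg hφ (ratio_nonneg (g n)) (ratio_le_one (hg n))
  rw [one_mul, mul_assoc]
  exact mul_le_mul_of_nonneg_right h1 (mul_nonneg ENNReal.toReal_nonneg h2)

lemma N1_le {φ ψ : ℝ → ℝ} (hφ : IsPhi φ) (hψ : IsPsi ψ) (f : ℝ → ℝ) :
    ENNReal.ofReal (ψ 1) * QANorm φ (fun _ => 1) f ≤ QANorm φ ψ f := by
  refine le_iInf₂ fun g hg => le_trans ?_ (cost_one_le hφ hψ hg.1)
  gcongr
  exact QANorm_le hg

/-- the unit ball -/
def QB (φ ψ : ℝ → ℝ) : Set (ℝ → ℝ) := {g : ℝ → ℝ | MemQA φ ψ g ∧ QANorm φ ψ g ≤ 1}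

open scoped Pointwise in
lemma mem_smul_hull {φ ψ : ℝ → ℝ} {f : ℝ → ℝ} (hf : AEMeasurable f μ01) {r : ℝ} (hr : 0 < r)
    (h : QANorm φ ψ f < ENNReal.ofReal r) : f ∈ r • convexHull ℝ (QB φ ψ) := by
  rw [mem_smul_set_iff_inv_smul_mem₀ hr.ne']
  apply subset_convexHull
  obtain ⟨g, hg, hc⟩ := exists_adm h
  have hr' : 0 < r⁻¹ := inv_pos.2 hr
  have h1 : QANorm φ ψ (r⁻¹ • f) ≤ 1 := by
    refine (QANorm_le (hg.smul hr')).trans ?_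
    rw [seqCost_smul _ _ _ hr']
    calc _ ≤ ENNReal.ofReal r⁻¹ * ENNReal.ofReal r := by gcongr
      _ = 1 := by rw [← ENNReal.ofReal_mul hr'.le, inv_mul_cancel₀ hr.ne', ENNReal.ofReal_one]
  exact ⟨⟨hf.const_smul _, lt_of_le_of_lt h1 one_lt_top⟩, h1⟩

open scoped Pointwise in
lemma lower_of_mem {φ ψ : ℝ → ℝ} (hφ : IsPhi φ) (hψ : IsPsi ψ) {f : ℝ → ℝ} {r : ℝ} (hr : 0 < r)
    (h : f ∈ r • convexHull ℝ (QB φ ψ)) :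
    ENNReal.ofReal (ψ 1) * lorentzNorm φ f ≤ ENNReal.ofReal r := by
  have hψ1 := hψ.pos 1 one_pos
  have hψ0 : ENNReal.ofReal (ψ 1) ≠ 0 := by simpa using hψ1
  rw [mem_smul_set_iff_inv_smul_mem₀ hr.ne'] at h
  have hsub : QB φ ψ ⊆ {f : ℝ → ℝ | AEMeasurable f μ01 ∧
      QANorm φ (fun _ => 1) f ≤ (ENNReal.ofReal (ψ 1))⁻¹} := by
    rintro g ⟨hg, hg1⟩
    refine ⟨hg.1, ?_⟩
    rw [ENNReal.le_inv_iff_mul_le, mul_comm]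
    exact (N1_le hφ hψ g).trans hg1
  obtain ⟨hm, hN⟩ := convexHull_min hsub (convex_N1 φ _) h
  have hfeq : f = r • (r⁻¹ • f) := by rw [smul_smul, mul_inv_cancel₀ hr.ne', one_smul]
  have hfm : AEMeasurable f μ01 := by rw [hfeq]; exact hm.const_smul r
  have hN' : QANorm φ (fun _ => 1) f ≤ ENNReal.ofReal r * (ENNReal.ofReal (ψ 1))⁻¹ := by
    have hfin : (ENNReal.ofReal (ψ 1))⁻¹ ≠ ⊤ := by simpa using hψ1
    refine ENNReal.le_of_forall_pos_le_add fun ε hε _ => ?_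
    have hε' : 0 < (ε : ℝ≥0∞) / ENNReal.ofReal r :=
      ENNReal.div_pos (by exact_mod_cast hε.ne') ENNReal.ofReal_ne_top
    obtain ⟨g, hg, hgc⟩ := exists_adm (lt_of_le_of_lt hN (ENNReal.lt_add_right hfin hε'.ne'))
    have := QANorm_le (φ := φ) (ψ := fun _ => 1) (hg.smul hr)
    rw [← hfeq, seqCost_smul _ _ _ hr] at this
    refine this.trans ?_
    calc _ ≤ ENNReal.ofReal r * ((ENNReal.ofReal (ψ 1))⁻¹ + ε / ENNReal.ofReal r) := by gcongr
      _ = _ := by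
        rw [mul_add, ENNReal.mul_div_cancel (by simpa using hr) ENNReal.ofReal_ne_top]
  calc ENNReal.ofReal (ψ 1) * lorentzNorm φ f
      ≤ ENNReal.ofReal (ψ 1) * (ENNReal.ofReal r * (ENNReal.ofReal (ψ 1))⁻¹) := by
        gcongr
        exact (lorentz_le_N1 hφ hfm).trans hN'
    _ = ENNReal.ofReal r := by
        rw [mul_comm, mul_assoc, ENNReal.inv_mul_cancel hψ0 ENNReal.ofReal_ne_top, mul_one]

lemma lorentz_lt_top {φ ψ : ℝ → ℝ} (hφ : IsPhi φ) (hψ : IsPsi ψ) {f : ℝ → ℝ}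
    (hf : MemQA φ ψ f) : lorentzNorm φ f < ⊤ := by
  have h := (N1_le hφ hψ f).trans_lt hf.2
  have hψ1 := hψ.pos 1 one_pos
  refine (lorentz_le_N1 hφ hf.1).trans_lt ?_
  by_contra! h2
  rw [top_le_iff.1 h2, ENNReal.mul_top (by simpa using hψ1)] at h
  exact lt_irrefl _ h

/-- A bounded function supported in `A`. -/
lemma QANorm_le_indicator {φ ψ : ℝ → ℝ} {x : ℝ → ℝ} {A : Set ℝ}
    (hA : MeasurableSet A) {δ : ℝ} (hδ : 0 < δ) (h : ∀ t, |x t| ≤ A.indicator (fun _ => δ) t)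
    (hφ : IsPhi φ) :
    QANorm φ ψ x ≤ ENNReal.ofReal (ψ 1 * δ * φ (μ01 A).toReal) := by
  set g : ℕ → ℝ → ℝ := fun n => if n = 0 then A.indicator (fun _ => δ) else 0 with hg
  have hadm : Admissible x g := by
    refine ⟨fun n => ?_, fun n => ?_, fun n t => ?_, Eventually.of_forall fun t => ?_⟩
    · simp only [hg]; split_ifs
      · exact (measurable_const.indicator hA).aemeasurable
      · exact aemeasurable_const
    · simp only [hg]; split_ifs
      · refine lt_of_le_of_lt (eLpNorm_indicator_le _) ?_
        rw [eLpNorm_const _ (by simp) (IsProbabilityMeasure.ne_zero _)]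
        simp
      · simp
    · simp only [hg]; split_ifs
      · exact indicator_nonneg (fun _ _ => hδ.le) _
      · simp
    · refine le_trans (ENNReal.ofReal_le_ofReal (h t)) ?_
      refine le_trans (le_of_eq ?_) (ENNReal.le_tsum 0)
      simp [hg]
  refine (QANorm_le hadm).trans (le_of_eq ?_)
  unfold seqCost
  rw [tsum_eq_single 0]
  · simp only [hg, if_true, Nat.cast_zero, zero_add]
    rcases eq_or_ne (μ01 A) 0 with h0 | h0
    · have : eLpNorm (A.indicator fun _ => δ) ⊤ μ01 = 0 := by
        rw [eLpNorm_eq_zero_iff ((measurable_const.indicator hA).aestronglyMeasurable) (by simp)]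
        exact indicator_meas_zero h0
      rw [this, h0]
      simp [hφ.zero]
    · rw [eLpNorm_indicator_const' hA h0 (by simp), eLpNorm_indicator_const' hA h0 (by simp),
        Real.enorm_eq_ofReal hδ.le]
      have hd : ENNReal.ofReal δ ≠ 0 := by simpa using hδ
      simp only [ENNReal.toReal_one, ENNReal.toReal_top, div_one, _root_.div_zero, ENNReal.rpow_one,
        ENNReal.rpow_zero, mul_one]
      rw [mul_div_assoc, ENNReal.mul_div_cancel hd ENNReal.ofReal_ne_top,
        ENNReal.toReal_ofReal hδ.le]
  · intro n hn
    simp [hg, hn]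

lemma phi_dist_anti {φ : ℝ → ℝ} (hφ : IsPhi φ) (f : ℝ → ℝ) :
    Antitone fun s : ℝ => ENNReal.ofReal (φ (μ01 {x | s < |f x|}).toReal) := by
  intro s t hst
  apply ENNReal.ofReal_le_ofReal
  exact hφ.mono ⟨ENNReal.toReal_nonneg, dist_toReal_le f t⟩
    ⟨ENNReal.toReal_nonneg, dist_toReal_le f s⟩
    (ENNReal.toReal_mono (measure_ne_top _ _) (dist_mono f hst))

lemma riemann_le {φ : ℝ → ℝ} (hφ : IsPhi φ) (f : ℝ → ℝ) {δ : ℝ} (hδ : 0 < δ) (K : ℕ) :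
    ∑ k ∈ Finset.range K, ENNReal.ofReal δ *
        ENNReal.ofReal (φ (μ01 {x | ((k:ℝ) + 1) * δ < |f x|}).toReal)
      ≤ ∫⁻ s in Ioc (0:ℝ) (K * δ), ENNReal.ofReal (φ (μ01 {x | s < |f x|}).toReal) := by
  induction K with
  | zero => simp
  | succ K ih =>
    have hU : Ioc (0:ℝ) (((K + 1 : ℕ) : ℝ) * δ) = Ioc 0 (K * δ) ∪ Ioc (K * δ) ((K + 1) * δ) := by
      rw [Ioc_union_Ioc_eq_Ioc (by positivity) (by nlinarith)]
      push_cast; rfl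
    rw [Finset.sum_range_succ, hU, lintegral_union measurableSet_Ioc (by simp)]
    refine add_le_add ih ?_
    calc _ = ∫⁻ s in Ioc ((K:ℝ) * δ) ((K + 1) * δ),
          ENNReal.ofReal (φ (μ01 {x | ((K:ℝ) + 1) * δ < |f x|}).toReal) := by
          rw [lintegral_const, Measure.restrict_apply_univ, Real.volume_Ioc, mul_comm]
          congr 2; ring
      _ ≤ _ := setLIntegral_mono' measurableSet_Ioc fun s hs => phi_dist_anti hφ f hs.2

/-- The staircase function. -/
def stair (δ : ℝ) (K : ℕ) (y : ℝ) : ℝ :=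
  ∑ k ∈ Finset.range K, if ((k:ℝ) + 1) * δ < y then δ else 0

lemma stair_bounds {δ : ℝ} (hδ : 0 < δ) {y : ℝ} (hy : 0 ≤ y) (K : ℕ) :
    stair δ K y ≤ y ∧ stair δ K y ≤ K * δ ∧ min y (((K:ℝ) + 1) * δ) ≤ stair δ K y + δ := by
  induction K with
  | zero => simp [stair, hy]
  | succ K ih =>
    obtain ⟨h1, h2, h3⟩ := ih
    have e : stair δ (K + 1) y = stair δ K y + if ((K:ℝ) + 1) * δ < y then δ else 0 := by
      unfold stair; rw [Finset.sum_range_succ]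
    rw [e]
    push_cast
    split_ifs with h
    · rw [min_eq_right h.le] at h3
      refine ⟨by nlinarith, by nlinarith, (min_le_right _ _).trans (by nlinarith)⟩
    · rw [min_eq_left (not_lt.1 h)] at h3
      refine ⟨by linarith, by nlinarith, (min_le_left _ _).trans (by linarith)⟩

/-- The layers as functions of the value. -/
def layerFun (δ : ℝ) (k : ℕ) (y : ℝ) : ℝ :=
  if ((k:ℝ) + 1) * δ < |y| then (if y < 0 then -δ else δ) else 0

lemma layerFun_meas (δ : ℝ) (k : ℕ) : Measurable (layerFun δ k) := by
  unfold layerFun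
  refine Measurable.ite (measurableSet_lt measurable_const measurable_id.abs) ?_ measurable_const
  exact Measurable.ite (measurableSet_lt measurable_id measurable_const) measurable_const
    measurable_const

lemma sum_layerFun (δ : ℝ) (K : ℕ) (y : ℝ) :
    ∑ k ∈ Finset.range K, layerFun δ k y = if y < 0 then - stair δ K |y| else stair δ K |y| := by
  unfold layerFun stair
  split_ifs
  · rw [← Finset.sum_neg_distrib]
    refine Finset.sum_congr rfl fun k _ => ?_
    split_ifs <;> simp
  · rfl

lemma abs_sub_layers {δ : ℝ} (hδ : 0 < δ) (K : ℕ) (y : ℝ) :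
    |y - ∑ k ∈ Finset.range K, layerFun δ k y| = |y| - stair δ K |y| := by
  rw [sum_layerFun]
  have := (stair_bounds hδ (abs_nonneg y) K).1
  split_ifs with h
  · rw [abs_of_neg h] at this ⊢
    rw [abs_of_nonpos (by linarith)]; ring
  · rw [abs_of_nonneg (not_lt.1 h)] at this ⊢
    rw [abs_of_nonneg (by linarith)]

open scoped Pointwise in
lemma sum_mem_smul {C : Set (ℝ → ℝ)} (hC : Convex ℝ C) (hne : C.Nonempty) (x : ℕ → ℝ → ℝ)
    (r : ℕ → ℝ) (hr : ∀ k, 0 ≤ r k) (K : ℕ) (h : ∀ k, x k ∈ r k • C) :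
    ∑ k ∈ Finset.range K, x k ∈ (∑ k ∈ Finset.range K, r k) • C := by
  induction K with
  | zero => simp [zero_smul_set hne]
  | succ K ih =>
    rw [Finset.sum_range_succ, Finset.sum_range_succ,
      hC.add_smul (Finset.sum_nonneg fun k _ => hr k) (hr K)]
    exact add_mem_add ih (h K)

lemma QANorm_layer {φ ψ : ℝ → ℝ} (hφ : IsPhi φ) (f : ℝ → ℝ) {δ : ℝ} (hδ : 0 < δ) (k : ℕ) :
    QANorm φ ψ (fun x => layerFun δ k (f x))
      ≤ ENNReal.ofReal (ψ 1 * δ * φ (μ01 {x | ((k:ℝ) + 1) * δ < |f x|}).toReal) := by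
  rw [← measure_toMeasurable {x | ((k:ℝ) + 1) * δ < |f x|}]
  refine QANorm_le_indicator (measurableSet_toMeasurable _ _) hδ (fun t => ?_) hφ
  unfold layerFun
  by_cases h : ((k:ℝ) + 1) * δ < |f t|
  · have hmem : t ∈ toMeasurable μ01 {x | ((k:ℝ) + 1) * δ < |f x|} :=
      subset_toMeasurable μ01 {x | ((k:ℝ) + 1) * δ < |f x|}
        (show t ∈ {x | ((k:ℝ) + 1) * δ < |f x|} from h)
    rw [if_pos h, indicator_of_mem hmem]
    split_ifs
    · rw [abs_neg, abs_of_pos hδ]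
    · rw [abs_of_pos hδ]
  · rw [if_neg h, abs_zero]
    exact indicator_nonneg (fun _ _ => hδ.le) _

lemma QANorm_rest {φ ψ : ℝ → ℝ} (hφ : IsPhi φ) (hψ : IsPsi ψ) {x : ℝ → ℝ} {g : ℕ → ℝ → ℝ}
    (hm : ∀ n, AEMeasurable (g n) μ01) (ht : ∀ n, eLpNorm (g n) ⊤ μ01 < ⊤)
    (h0 : ∀ n x, 0 ≤ g n x) {δ : ℝ} (hδ : 0 < δ) {N : ℕ} (hN : 1 ≤ N)
    (h : ∀ᵐ t ∂μ01, ENNReal.ofReal |x t| ≤ ENNReal.ofReal δ + ∑' n, ENNReal.ofReal (g (n + N) t)) :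
    QANorm φ ψ x ≤ ENNReal.ofReal (ψ 1 * δ * φ 1) +
      ∑' n : ℕ, ENNReal.ofReal (ψ (((n + N : ℕ) : ℝ) + 1) * (eLpNorm (g (n + N)) ⊤ μ01).toReal *
      φ ((eLpNorm (g (n + N)) 1 μ01 / eLpNorm (g (n + N)) ⊤ μ01).toReal)) := by
  set r : ℕ → ℝ → ℝ := fun n => if n = 0 then (fun _ => δ) else g (n - 1 + N) with hr
  have hc : ∀ p : ℝ≥0∞, p ≠ 0 → eLpNorm (fun _ : ℝ => δ) p μ01 = ENNReal.ofReal δ := by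
    intro p hp
    rw [eLpNorm_const _ hp (IsProbabilityMeasure.ne_zero _), Real.enorm_eq_ofReal hδ.le]
    simp
  have hadm : Admissible x r := by
    refine ⟨fun n => ?_, fun n => ?_, fun n t => ?_, ?_⟩
    · simp only [hr]; split_ifs
      · exact aemeasurable_const
      · exact hm _
    · simp only [hr]; split_ifs
      · rw [hc _ (by simp)]; simp
      · exact ht _
    · simp only [hr]; split_ifs
      · exact hδ.le
      · exact h0 _ _
    · filter_upwards [h] with t ht
      rw [tsum_eq_zero_add' ENNReal.summable]
      simpa [hr] using ht
  refine (QANorm_le hadm).trans ?_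
  unfold seqCost
  rw [tsum_eq_zero_add' ENNReal.summable]
  refine add_le_add (le_of_eq ?_) (ENNReal.tsum_le_tsum fun n => ?_)
  · simp only [hr, if_true, Nat.cast_zero, zero_add]
    rw [hc _ (by simp), hc _ (by simp), ENNReal.div_self (by simpa using hδ) ENNReal.ofReal_ne_top,
      ENNReal.toReal_ofReal hδ.le, ENNReal.toReal_one]
  · have e : r (n + 1) = g (n + N) := by simp [hr]
    rw [e]
    apply ENNReal.ofReal_le_ofReal
    have hNr : (1:ℝ) ≤ N := by exact_mod_cast hN
    have hn0 : (0:ℝ) ≤ n := Nat.cast_nonneg n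
    have h1 : ψ (((n + 1 : ℕ) : ℝ) + 1) ≤ ψ (((n + N : ℕ) : ℝ) + 1) := by
      refine hψ.mono ?_ ?_ ?_
      · simp only [mem_Ici]; positivity
      · simp only [mem_Ici]; positivity
      · push_cast; linarith
    have h2 : 0 ≤ φ ((eLpNorm (g (n + N)) 1 μ01 / eLpNorm (g (n + N)) ⊤ μ01).toReal) :=
      phi_nonneg hφ (ratio_nonneg (g (n + N))) (ratio_le_one (hm (n + N)))
    rw [mul_assoc, mul_assoc]
    exact mul_le_mul_of_nonneg_right h1 (mul_nonneg ENNReal.toReal_nonneg h2)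

lemma gauge_upper {φ ψ : ℝ → ℝ} (hφ : IsPhi φ) (hψ : IsPsi ψ) {f : ℝ → ℝ} (hf : MemQA φ ψ f) :
    gauge (convexHull ℝ (QB φ ψ)) f ≤ ψ 1 * (lorentzNorm φ f).toReal := by
  have hψ1 := hψ.pos 1 one_pos
  have hφ1 := hφ.pos 1 one_pos le_rfl
  have hL := lorentz_lt_top hφ hψ hf
  refine le_of_forall_pos_le_add fun ε hε => ?_
  obtain ⟨g, ⟨hm, ht, h0, hle⟩, hgc⟩ := exists_adm hf.2
  -- choice of the tail
  have htail := ENNReal.tendsto_sum_nat_add _ hgc.ne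
  have hε4 : (0:ℝ≥0∞) < ENNReal.ofReal (ε / 4) := by simpa using hε
  obtain ⟨N, hN, hN1⟩ := ((htail.eventually_lt_const hε4).and (eventually_ge_atTop 1)).exists
  set δ : ℝ := ε / (4 * ψ 1 * φ 1) with hδdef
  have hδ : 0 < δ := by positivity
  have hδe : ψ 1 * δ * φ 1 = ε / 4 := by rw [hδdef]; field_simp
  -- bound of the head
  set M : ℝ≥0∞ := ∑ n ∈ Finset.range N, eLpNorm (g n) ⊤ μ01 with hM
  have hMt : M ≠ ⊤ := (ENNReal.sum_lt_top.2 fun n _ => ht n).ne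
  obtain ⟨K, hK⟩ := exists_nat_gt (M.toReal / δ)
  have hK' : M ≤ ENNReal.ofReal (K * δ) := by
    rw [← ENNReal.ofReal_toReal hMt]
    apply ENNReal.ofReal_le_ofReal
    rw [div_lt_iff₀ hδ] at hK; exact hK.le
  set R : ℝ → ℝ := fun x => f x - ∑ k ∈ Finset.range K, layerFun δ k (f x) with hR
  have hRm : AEMeasurable R μ01 := by
    refine hf.1.sub ?_
    exact Finset.aemeasurable_fun_sum _ fun k _ => (layerFun_meas δ k).comp_aemeasurable hf.1
  have hRle : ∀ᵐ t ∂μ01, ENNReal.ofReal |R t|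
      ≤ ENNReal.ofReal δ + ∑' n, ENNReal.ofReal (g (n + N) t) := by
    have h2 := ae_all_iff.2 fun n => ae_le_top (h0 n)
    filter_upwards [hle, h2] with t ht1 ht2
    obtain ⟨hs1, hs2, hs3⟩ := stair_bounds hδ (abs_nonneg (f t)) K
    rw [hR]
    simp only
    rw [abs_sub_layers hδ]
    rcases le_total |f t| (((K:ℝ) + 1) * δ) with hc | hc
    · rw [min_eq_left hc] at hs3
      exact (ENNReal.ofReal_le_ofReal (by linarith)).trans le_self_add
    · rw [min_eq_right hc] at hs3
      have hst : (K:ℝ) * δ ≤ stair δ K |f t| := by linarith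
      rw [ENNReal.ofReal_sub _ (le_trans (by positivity) hst)]
      refine (tsub_le_iff_left.2 ?_ : _ ≤ ∑' n, ENNReal.ofReal (g (n + N) t)).trans le_add_self
      refine ht1.trans ?_
      rw [← ENNReal.summable.sum_add_tsum_nat_add' (k := N)]
      refine add_le_add ?_ le_rfl
      refine le_trans ?_ (hK'.trans (ENNReal.ofReal_le_ofReal hst))
      exact Finset.sum_le_sum fun n _ => ht2 n
  have hRn : QANorm φ ψ R < ENNReal.ofReal (ε / 2) := by
    refine lt_of_le_of_lt (QANorm_rest hφ hψ hm ht h0 hδ hN1 hRle) ?_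
    rw [hδe]
    have : ENNReal.ofReal (ε / 2) = ENNReal.ofReal (ε / 4) + ENNReal.ofReal (ε / 4) := by
      rw [← ENNReal.ofReal_add (by positivity) (by positivity)]; congr 1; ring
    rw [this]
    exact ENNReal.add_lt_add_left ENNReal.ofReal_ne_top hN
  have hC : Convex ℝ (convexHull ℝ (QB φ ψ)) := convex_convexHull ℝ _
  have hRmem := mem_smul_hull hRm (by positivity) hRn
  have hne : (convexHull ℝ (QB φ ψ)).Nonempty := by
    obtain ⟨y, hy, _⟩ := hRmem
    exact ⟨y, hy⟩
  set η : ℝ := ε / (2 * ((K:ℝ) + 1)) with hη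
  have hηpos : 0 < η := by positivity
  set p : ℕ → ℝ := fun k => φ (μ01 {x | ((k:ℝ) + 1) * δ < |f x|}).toReal with hp
  have hp0 : ∀ k, 0 ≤ p k := fun k => phi_nonneg hφ ENNReal.toReal_nonneg (dist_toReal_le _ _)
  have hlay := sum_mem_smul hC hne (fun k x => layerFun δ k (f x))
    (fun k => ψ 1 * δ * p k + η) (fun k => by have := hp0 k; positivity) K (fun k => by
      have := hp0 k
      refine mem_smul_hull ((layerFun_meas δ k).comp_aemeasurable hf.1) (by positivity) ?_
      refine lt_of_le_of_lt (QANorm_layer hφ f hδ k) ?_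
      rw [ENNReal.ofReal_lt_ofReal_iff (by positivity)]
      linarith)
  have hsum0 : 0 ≤ ∑ k ∈ Finset.range K, (ψ 1 * δ * p k + η) :=
    Finset.sum_nonneg fun k _ => by have := hp0 k; positivity
  have hadd := Set.add_mem_add hlay hRmem
  rw [← hC.add_smul hsum0 (by positivity)] at hadd
  have hfe : (∑ k ∈ Finset.range K, (fun x => layerFun δ k (f x))) + R = f := by
    ext x
    simp [hR, Finset.sum_apply]
  rw [hfe] at hadd
  refine (gauge_le_of_mem (by positivity) hadd).trans ?_
  have hrie : δ * ∑ k ∈ Finset.range K, p k ≤ (lorentzNorm φ f).toReal := by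
    have h1 := (riemann_le hφ f hδ K).trans (lintegral_mono_set (Ioc_subset_Ioi_self))
    rw [← lorentz_eq hφ hf.1, ← Finset.mul_sum,
      ← ENNReal.ofReal_sum_of_nonneg (fun k _ => hp0 k), ← ENNReal.ofReal_mul hδ.le] at h1
    exact (ENNReal.ofReal_le_iff_le_toReal hL.ne).1 h1
  have hηK : K * η ≤ ε / 2 := by
    rw [hη, mul_div_assoc', div_le_div_iff₀ (by positivity) (by positivity)]
    nlinarith
  rw [Finset.sum_add_distrib, ← Finset.mul_sum, Finset.sum_const, Finset.card_range, nsmul_eq_mul]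
  have := mul_le_mul_of_nonneg_left hrie hψ1.le
  nlinarith

lemma gauge_lower {φ ψ : ℝ → ℝ} (hφ : IsPhi φ) (hψ : IsPsi ψ) {f : ℝ → ℝ} (hf : MemQA φ ψ f) :
    ψ 1 * (lorentzNorm φ f).toReal ≤ gauge (convexHull ℝ (QB φ ψ)) f := by
  have hψ1 := hψ.pos 1 one_pos
  rw [gauge_def]
  refine le_csInf ?_ ?_
  · have h1 : 0 < (QANorm φ ψ f).toReal + 1 := by positivity
    refine ⟨(QANorm φ ψ f).toReal + 1, h1, mem_smul_hull hf.1 h1 ?_⟩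
    rw [ENNReal.lt_ofReal_iff_toReal_lt hf.2.ne]
    linarith
  · rintro r ⟨hr, hmem⟩
    have := lower_of_mem hφ hψ hr hmem
    have h2 := ENNReal.toReal_mono ENNReal.ofReal_ne_top this
    rwa [ENNReal.toReal_mul, ENNReal.toReal_ofReal hψ1.le, ENNReal.toReal_ofReal (le_of_lt hr)] at h2

lemma qa_dense {φ ψ : ℝ → ℝ} (hφ : IsPhi φ) {h : ℝ → ℝ} (hh : MemLorentz φ h)
    {ε : ℝ} (hε : 0 < ε) :
    ∃ g : ℝ → ℝ, MemQA φ ψ g ∧ lorentzNorm φ (h - g) < ENNReal.ofReal ε := by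
  obtain ⟨hm, hL⟩ := hh
  rw [lorentz_eq hφ hm] at hL
  set Φ : ℝ → ℝ≥0∞ := fun s => ENNReal.ofReal (φ (μ01 {x | s < |h x|}).toReal) with hΦ
  have hΦm : Measurable Φ := (phi_dist_anti hφ h).measurable
  have hlim := tendsto_measure_iInter_atTop (μ := volume.withDensity Φ)
    (s := fun n : ℕ => Ioi (n:ℝ)) (fun n => measurableSet_Ioi.nullMeasurableSet)
    (fun m n hmn => Ioi_subset_Ioi (by exact_mod_cast hmn))
    ⟨0, by rw [withDensity_apply _ measurableSet_Ioi]; simpa using hL.ne⟩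
  have hemp : (⋂ n : ℕ, Ioi (n:ℝ)) = ∅ := by
    ext x
    simp only [mem_iInter, mem_Ioi, mem_empty_iff_false, iff_false, not_forall, not_lt]
    exact exists_nat_ge x
  rw [hemp, measure_empty] at hlim
  obtain ⟨n, hn, hn1⟩ := ((hlim.eventually_lt_const (u := ENNReal.ofReal ε) (by simpa using hε)).and
    (eventually_ge_atTop 1)).exists
  change (volume.withDensity Φ) (Ioi (n:ℝ)) < ENNReal.ofReal ε at hn
  rw [withDensity_apply _ measurableSet_Ioi] at hn
  have hnpos : (0:ℝ) < n := by exact_mod_cast hn1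
  set g : ℝ → ℝ := fun x => max (-(n:ℝ)) (min (h x) n) with hg
  have hgm : AEMeasurable g μ01 := aemeasurable_const.max (hm.min aemeasurable_const)
  refine ⟨g, ⟨hgm, ?_⟩, ?_⟩
  · refine lt_of_le_of_lt (QANorm_le_indicator (A := univ) MeasurableSet.univ hnpos (fun t => ?_) hφ)
      ENNReal.ofReal_lt_top
    rw [indicator_univ, abs_le]
    exact ⟨le_max_left _ _, max_le (by linarith) (min_le_right _ _)⟩
  · rw [lorentz_eq hφ (hm.sub hgm)]
    refine lt_of_le_of_lt (le_of_eq ?_) hn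
    rw [← (measurePreserving_add_right volume (n:ℝ)).setLIntegral_comp_preimage measurableSet_Ioi hΦm]
    have : (fun x : ℝ => x + n) ⁻¹' (Ioi (n:ℝ)) = Ioi 0 := by ext; simp
    rw [this]
    refine setLIntegral_congr_fun measurableSet_Ioi fun s hs => ?_
    have hs' : 0 < s := hs
    have : {x | s < |(h - g) x|} = {x | s + n < |h x|} := by
      ext x
      simp only [mem_ofPred_eq, Pi.sub_apply, hg]
      rcases le_total (h x) (-n) with h1 | h1
      · rw [min_eq_left (by linarith), max_eq_left h1, abs_of_nonpos (by linarith),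
          abs_of_nonpos (by linarith)]
        constructor <;> intro h <;> linarith
      · rcases le_total (h x) n with h2 | h2
        · rw [min_eq_left h2, max_eq_right h1, sub_self, abs_zero]
          have := abs_le.2 ⟨h1, h2⟩
          constructor <;> intro h <;> linarith
        · rw [min_eq_right h2, max_eq_right (by linarith), abs_of_nonneg (by linarith),
            abs_of_nonneg (by linarith)]
          constructor <;> intro h <;> linarith
    simp only [hΦ, this]

/-- the Banach envelope of `QA_{φ,ψ}` is `Λ_φ`: the Mackey norm (the gauge of
the convex hull of the unit ball of `QA_{φ,ψ}`) equals `ψ(1) ‖·‖_{Λ_φ}` on `QA_{φ,ψ}`, and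
`QA_{φ,ψ}` is dense in `Λ_φ`, so the completion of `(QA_{φ,ψ}, ‖·‖^c)` is
`(Λ_φ, ψ(1)‖·‖_{Λ_φ})`. -/
theorem stmt11 {φ ψ : ℝ → ℝ} (hφ : IsPhi φ) (hψ : IsPsi ψ) :
    (∀ f : ℝ → ℝ, MemQA φ ψ f →
      gauge (convexHull ℝ {g : ℝ → ℝ | MemQA φ ψ g ∧ QANorm φ ψ g ≤ 1}) f
        = ψ 1 * (lorentzNorm φ f).toReal) ∧
    (∀ h : ℝ → ℝ, MemLorentz φ h → ∀ ε : ℝ, 0 < ε →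
      ∃ g : ℝ → ℝ, MemQA φ ψ g ∧ lorentzNorm φ (h - g) < ENNReal.ofReal ε) := by
  exact ⟨fun f hf => le_antisymm (gauge_upper hφ hψ hf) (gauge_lower hφ hψ hf),
    fun h hh ε hε => qa_dense hφ hh hε⟩
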